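/- Let k be an algebraically closed field of characteristic 0. The defining ideal J(V(1,2)) of the Nichols algebra of the block V(1,2) is the two-sided ideal of the free algebra k⟨x_1,x_2⟩ generated by the single element x_2x_1 − x_1x_2 + (1/2)x_1²; the images of the monomials x_1^a x_2^b for (a,b) ∈ ℕ² form a k-basis of B(V(1,2)); and GKdim B(V(1,2)) = 2. (This Nichols algebra is the Jordan plane.) -/

import Mathlib

open scoped ENNReal

/-- The Gelfand–Kirillov dimension of a `k`-algebra `A`. -/
noncomputable def GKdim (k A : Type*) [Field k] [Ring A] [Algebra k A] : ℝ≥0∞ :=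
  ⨆ (V : Submodule k A) (_ : FiniteDimensional k V),
    Filter.limsup
      (fun n : ℕ =>
        ENNReal.ofReal
          (Real.log ((Module.finrank k (↥(∑ j ∈ Finset.range (n + 1), V ^ j)) : ℕ) : ℝ) /
            Real.log (n : ℝ)))
      Filter.atTop

/-- The degree-`n` homogeneous component of the free algebra on `2` generators. -/
noncomputable def degComp (k : Type*) [Field k] (n : ℕ) :
    Submodule k (FreeAlgebra k (Fin 2)) :=
  (Submodule.span k (Set.range (FreeAlgebra.ι k : Fin 2 → FreeAlgebra k (Fin 2)))) ^ n

/-- Generating set of the defining ideal `J(V(1,2))` of the Nichols algebra. -/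
def nicholsSet {k : Type*} [Field k]
    (D : Fin 2 → (FreeAlgebra k (Fin 2) →ₗ[k] FreeAlgebra k (Fin 2))) :
    Set (FreeAlgebra k (Fin 2)) :=
  {x | ∃ n : ℕ, 2 ≤ n ∧ x ∈ degComp k n ∧
    ∀ l : List (Fin 2), l.length = n → l.foldr (fun i y => D i y) x = 0}

/-- Relation presenting the Nichols algebra `B(V(1,2))` as a `RingQuot`. -/
def nicholsRel {k : Type*} [Field k]
    (D : Fin 2 → (FreeAlgebra k (Fin 2) →ₗ[k] FreeAlgebra k (Fin 2)))
    (a b : FreeAlgebra k (Fin 2)) : Prop :=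
  a ∈ nicholsSet D ∧ b = 0

/-- The extension to the free algebra of the action of `g` on the block `V(1,2)`:
`g·x₁ = x₁`, `g·x₂ = x₂ + x₁`. -/
noncomputable def jordanAut (k : Type*) [Field k] :
    FreeAlgebra k (Fin 2) →ₐ[k] FreeAlgebra k (Fin 2) :=
  FreeAlgebra.lift k
    ![FreeAlgebra.ι k (0 : Fin 2),
      FreeAlgebra.ι k (1 : Fin 2) + FreeAlgebra.ι k (0 : Fin 2)]

/-- The monomial `X ^ a * Y ^ b` indexed by the pair `(a, b)`. -/
def orderedMonomial {A : Type*} [Monoid A] (X Y : A) (p : ℕ × ℕ) : A :=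
  X ^ p.1 * Y ^ p.2

theorem map_orderedMonomial {A B F : Type*} [Monoid A] [Monoid B] [FunLike F A B]
    [MonoidHomClass F A B] (f : F) (X Y : A) (p : ℕ × ℕ) :
    f (orderedMonomial X Y p) = orderedMonomial (f X) (f Y) p := by
  simp [orderedMonomial]

section JordanRelation

variable {k A : Type*} [Field k] [Ring A] [Algebra k A] {X Y : A}

theorem mul_pow_of_jordan_relation (h : Y * X = X * Y - (2 : k)⁻¹ • (X * X)) (a : ℕ) :
    Y * X ^ a = X ^ a * Y - ((a : k) * 2⁻¹) • X ^ (a + 1) := by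
  induction a with
  | zero => simp
  | succ a ih =>
    rw [pow_succ, ← mul_assoc, ih, sub_mul, mul_assoc, h, mul_sub, smul_mul_assoc,
      mul_smul_comm, ← pow_succ, pow_succ X (a + 1), pow_succ X a]
    simp only [mul_assoc]
    push_cast
    module

theorem mul_orderedMonomial_left (p : ℕ × ℕ) :
    X * orderedMonomial X Y p = orderedMonomial X Y (p.1 + 1, p.2) := by
  simp only [orderedMonomial, pow_succ', mul_assoc]

theorem mul_orderedMonomial_right (h : Y * X = X * Y - (2 : k)⁻¹ • (X * X)) (p : ℕ × ℕ) :
    Y * orderedMonomial X Y p = orderedMonomial X Y (p.1, p.2 + 1) -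
      ((p.1 : k) * 2⁻¹) • orderedMonomial X Y (p.1 + 1, p.2) := by
  simp only [orderedMonomial]
  rw [← mul_assoc, mul_pow_of_jordan_relation h, sub_mul, smul_mul_assoc, mul_assoc, ← pow_succ']

variable (k) in
/-- The span of the ordered monomials of degree at most `m`. -/
def monomialFiltration (X Y : A) (m : ℕ) : Submodule k A :=
  Submodule.span k (orderedMonomial X Y '' {p | p.1 + p.2 ≤ m})

variable (k) in
/-- The span of `1` and two elements. -/
def spanOneXY (X Y : A) : Submodule k A := Submodule.span k {1, X, Y}

theorem spanOneXY_pow_le (h : Y * X = X * Y - (2 : k)⁻¹ • (X * X)) (m : ℕ) :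
    spanOneXY k X Y ^ m ≤ monomialFiltration k X Y m := by
  induction m with
  | zero =>
    rw [pow_zero, Submodule.one_le]
    exact Submodule.subset_span ⟨(0, 0), by simp, by simp [orderedMonomial]⟩
  | succ m ih =>
    rw [pow_succ']
    refine (mul_le_mul_right ih _).trans ?_
    rw [spanOneXY, monomialFiltration, Submodule.span_mul_span, Submodule.span_le]
    rintro _ ⟨u, hu, _, ⟨p, hp, rfl⟩, rfl⟩
    have mem : ∀ q : ℕ × ℕ, q.1 + q.2 ≤ m + 1 →
        orderedMonomial X Y q ∈ monomialFiltration k X Y (m + 1) :=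
      fun q hq => Submodule.subset_span ⟨q, hq, rfl⟩
    simp only [Set.mem_ofPred_eq] at hp
    rcases hu with rfl | rfl | rfl
    · simpa using mem p (by omega)
    · simpa only [mul_orderedMonomial_left, SetLike.mem_coe] using mem (p.1 + 1, p.2) (by simp; omega)
    · simp only [mul_orderedMonomial_right h]
      exact sub_mem (mem _ (by simp; omega)) (Submodule.smul_mem _ _ (mem _ (by simp; omega)))

theorem monotone_spanOneXY_pow (X Y : A) : Monotone (spanOneXY k X Y ^ ·) :=
  pow_right_monotone (Submodule.one_le.2 (Submodule.subset_span (by simp)))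

theorem exists_mem_spanOneXY_pow {φ : FreeAlgebra k (Fin 2) →ₐ[k] A}
    (hX : φ (FreeAlgebra.ι k 0) = X) (hY : φ (FreeAlgebra.ι k 1) = Y)
    (z : FreeAlgebra k (Fin 2)) : ∃ m, φ z ∈ spanOneXY k X Y ^ m := by
  induction z using FreeAlgebra.induction with
  | grade0 r => exact ⟨0, by rw [AlgHom.commutes, pow_zero]; exact Submodule.algebraMap_mem r⟩
  | grade1 i =>
    refine ⟨1, ?_⟩
    rw [pow_one]
    fin_cases i
    · exact Submodule.subset_span (by simp [hX])
    · exact Submodule.subset_span (by simp [hY])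
  | mul a b ha hb =>
    obtain ⟨m, hm⟩ := ha
    obtain ⟨n, hn⟩ := hb
    exact ⟨m + n, by rw [map_mul, pow_add]; exact Submodule.mul_mem_mul hm hn⟩
  | add a b ha hb =>
    obtain ⟨m, hm⟩ := ha
    obtain ⟨n, hn⟩ := hb
    rw [map_add]
    exact ⟨max m n, add_mem (monotone_spanOneXY_pow X Y (le_max_left m n) hm)
      (monotone_spanOneXY_pow X Y (le_max_right m n) hn)⟩

theorem mem_span_range_orderedMonomial (h : Y * X = X * Y - (2 : k)⁻¹ • (X * X))
    {φ : FreeAlgebra k (Fin 2) →ₐ[k] A}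
    (hX : φ (FreeAlgebra.ι k 0) = X) (hY : φ (FreeAlgebra.ι k 1) = Y)
    (z : FreeAlgebra k (Fin 2)) :
    φ z ∈ Submodule.span k (Set.range (orderedMonomial X Y)) := by
  obtain ⟨m, hm⟩ := exists_mem_spanOneXY_pow hX hY z
  exact Submodule.span_mono (Set.image_subset_range _ _) (spanOneXY_pow_le h m hm)

theorem monomialFiltration_le_span_image (X Y : A) (m : ℕ) :
    monomialFiltration k X Y m ≤ Submodule.span k
      (orderedMonomial X Y '' ↑(Finset.range (m + 1) ×ˢ Finset.range (m + 1))) := by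
  refine Submodule.span_mono (Set.image_mono fun p hp => ?_)
  simp only [Set.mem_ofPred_eq] at hp
  simp only [Finset.coe_product, Finset.coe_range, Set.mem_prod, Set.mem_Iio]
  omega

instance (X Y : A) (s : Finset (ℕ × ℕ)) :
    FiniteDimensional k (Submodule.span k (orderedMonomial X Y '' (s : Set (ℕ × ℕ)))) :=
  FiniteDimensional.span_of_finite k (s.finite_toSet.image _)

theorem Submodule.sum_le_of_forall_le {ι : Type*} {s : Finset ι} {f : ι → Submodule k A}
    {W : Submodule k A} (h : ∀ i ∈ s, f i ≤ W) : ∑ i ∈ s, f i ≤ W :=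
  Finset.sum_induction f (· ≤ W) (fun _ _ ha hb => sup_le ha hb) bot_le h

theorem finrank_le_of_le_monomialFiltration {X Y : A} {m : ℕ} {W : Submodule k A}
    (hW : W ≤ monomialFiltration k X Y m) : Module.finrank k W ≤ (m + 1) ^ 2 := by
  classical
  refine (Submodule.finrank_mono (hW.trans (monomialFiltration_le_span_image X Y m))).trans ?_
  rw [← Finset.coe_image]
  refine (finrank_span_finset_le_card (R := k) _).trans (Finset.card_image_le.trans ?_)
  simp [sq]

theorem le_finrank_of_linearIndependent (hli : LinearIndependent k (orderedMonomial X Y))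
    (h : Y * X = X * Y - (2 : k)⁻¹ • (X * X)) (n : ℕ) :
    (n / 2 + 1) ^ 2 ≤
      Module.finrank k ↥(∑ j ∈ Finset.range (n + 1), spanOneXY k X Y ^ j) := by
  classical
  set s := Finset.range (n / 2 + 1) ×ˢ Finset.range (n / 2 + 1) with hs
  have hsub : Submodule.span k (orderedMonomial X Y '' (s : Set (ℕ × ℕ))) ≤
      ∑ j ∈ Finset.range (n + 1), spanOneXY k X Y ^ j := by
    refine le_trans ?_ (Finset.single_le_sum_of_canonicallyOrdered
      (f := fun j => spanOneXY k X Y ^ j) (Finset.self_mem_range_succ n))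
    rw [Submodule.span_le]
    rintro _ ⟨p, hp, rfl⟩
    simp only [hs, Finset.coe_product, Finset.coe_range, Set.mem_prod, Set.mem_Iio] at hp
    refine monotone_spanOneXY_pow X Y (show p.1 + p.2 ≤ n by omega) ?_
    simp only [pow_add]
    exact Submodule.mul_mem_mul (Submodule.pow_mem_pow _ (Submodule.subset_span (by simp)) _)
      (Submodule.pow_mem_pow _ (Submodule.subset_span (by simp)) _)
  have hle : ∑ j ∈ Finset.range (n + 1), spanOneXY k X Y ^ j ≤ monomialFiltration k X Y n := by
    refine Submodule.sum_le_of_forall_le fun j hj => ?_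
    exact (monotone_spanOneXY_pow X Y (Finset.mem_range_succ_iff.1 hj)).trans
      (spanOneXY_pow_le h n)
  have := Submodule.finiteDimensional_of_le
    (hle.trans (monomialFiltration_le_span_image X Y n))
  refine le_trans (le_of_eq ?_) (Submodule.finrank_mono hsub)
  rw [← Finset.coe_image, finrank_span_finset_eq_card,
    Finset.card_image_of_injective _ hli.injective]
  · simp [hs, sq]
  · rw [Finset.coe_image]
    exact hli.linearIndepOn_id.mono (Set.image_subset_range _ _)

theorem exists_le_spanOneXY_pow (hsurj : ∀ x : A, ∃ m, x ∈ spanOneXY k X Y ^ m)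
    (V : Submodule k A) [FiniteDimensional k V] : ∃ m, V ≤ spanOneXY k X Y ^ m := by
  choose f hf using hsurj
  obtain ⟨s, rfl⟩ := (Submodule.fg_top V).1 (Module.Finite.fg_top (R := k) (M := V))
  refine ⟨s.sup f, Submodule.span_le.2 fun x hx => ?_⟩
  exact monotone_spanOneXY_pow X Y (Finset.le_sup hx) (hf x)

theorem finrank_sum_pow_le (h : Y * X = X * Y - (2 : k)⁻¹ • (X * X)) {V : Submodule k A} {m : ℕ}
    (hV : V ≤ spanOneXY k X Y ^ m) (n : ℕ) :
    Module.finrank k ↥(∑ j ∈ Finset.range (n + 1), V ^ j) ≤ (m * n + 1) ^ 2 := by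
  refine finrank_le_of_le_monomialFiltration (X := X) (Y := Y) (le_trans ?_ (spanOneXY_pow_le h _))
  refine Submodule.sum_le_of_forall_le fun j hj => (pow_le_pow_left' hV j).trans ?_
  rw [← pow_mul]
  exact monotone_spanOneXY_pow X Y (Nat.mul_le_mul_left m (Finset.mem_range_succ_iff.1 hj))

open Filter Topology in
theorem tendsto_two_mul_log_mul_div_log {c : ℝ} (hc : 0 < c) :
    Tendsto (fun n : ℕ => ENNReal.ofReal (2 * Real.log (c * n) / Real.log n)) atTop (𝓝 2) := by
  have h1 : Tendsto (fun n : ℕ => Real.log n) atTop atTop :=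
    Real.tendsto_log_atTop.comp tendsto_natCast_atTop_atTop
  have h2 : Tendsto (fun n : ℕ => 2 * (Real.log c * (Real.log n)⁻¹ + 1)) atTop
      (𝓝 (2 * (Real.log c * 0 + 1))) :=
    ((h1.inv_tendsto_atTop.const_mul _).add_const 1).const_mul 2
  rw [show (2 : ℝ≥0∞) = ENNReal.ofReal (2 * (Real.log c * 0 + 1)) by simp]
  refine ENNReal.tendsto_ofReal (h2.congr' ?_)
  filter_upwards [eventually_ge_atTop 2] with n hn
  have hn' : (1 : ℝ) < n := by exact_mod_cast hn
  have hlog : Real.log n ≠ 0 := (Real.log_pos hn').ne'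
  rw [Real.log_mul hc.ne' (by positivity)]
  field_simp

open Filter in
theorem GKdim_eq_two_of_jordan_relation (h : Y * X = X * Y - (2 : k)⁻¹ • (X * X))
    (hli : LinearIndependent k (orderedMonomial X Y))
    (hsurj : ∀ x : A, ∃ m, x ∈ spanOneXY k X Y ^ m) : GKdim k A = 2 := by
  apply le_antisymm
  · refine iSup₂_le fun V hV => ?_
    obtain ⟨m, hm⟩ := exists_le_spanOneXY_pow hsurj V
    rw [← (tendsto_two_mul_log_mul_div_log (c := m + 1) (by positivity)).limsup_eq]
    refine limsup_le_limsup ?_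
    filter_upwards [eventually_ge_atTop 2] with n hn
    have hn' : (1 : ℝ) < n := by exact_mod_cast hn
    refine ENNReal.ofReal_le_ofReal (div_le_div_of_nonneg_right ?_ (Real.log_pos hn').le)
    rw [show (2 : ℝ) * Real.log ((m + 1) * n) = Real.log (((m + 1) * n) ^ 2) by simp]
    rcases (Module.finrank k ↥(∑ j ∈ Finset.range (n + 1), V ^ j)).eq_zero_or_pos with h0 | h0
    · rw [h0, Nat.cast_zero, Real.log_zero]
      exact Real.log_nonneg (one_le_pow₀ (by nlinarith [m.cast_nonneg (α := ℝ)]))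
    refine Real.log_le_log (by exact_mod_cast h0) ?_
    have := finrank_sum_pow_le h hm n
    calc _ ≤ (((m * n + 1) ^ 2 : ℕ) : ℝ) := by exact_mod_cast this
      _ ≤ _ := by
        push_cast
        gcongr
        linarith
  · have : FiniteDimensional k (spanOneXY k X Y) :=
      FiniteDimensional.span_of_finite k (by simp)
    refine le_trans ?_ (le_iSup₂ (spanOneXY k X Y) this)
    rw [← (tendsto_two_mul_log_mul_div_log (c := 1 / 2) (by positivity)).limsup_eq]
    refine limsup_le_limsup ?_
    filter_upwards [eventually_ge_atTop 2] with n hn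
    have hn' : (1 : ℝ) < n := by exact_mod_cast hn
    refine ENNReal.ofReal_le_ofReal (div_le_div_of_nonneg_right ?_ (Real.log_pos hn').le)
    rw [show (2 : ℝ) * Real.log (1 / 2 * n) = Real.log ((1 / 2 * n) ^ 2) by simp]
    refine Real.log_le_log (by positivity) ?_
    calc (1 / 2 * (n : ℝ)) ^ 2 ≤ (((n / 2 + 1) ^ 2 : ℕ) : ℝ) := by
          have : (n : ℝ) ≤ 2 * ((n / 2 : ℕ) + 1) := by exact_mod_cast (by omega)
          push_cast
          gcongr
          linarith
      _ ≤ _ := by exact_mod_cast le_finrank_of_linearIndependent hli h n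

end JordanRelation

section SkewDerivations

open FreeAlgebra

variable {k : Type*} [Field k]

@[simp]
theorem jordanAut_ι_zero : jordanAut k (ι k 0) = ι k 0 := by simp [jordanAut]

@[simp]
theorem jordanAut_ι_one : jordanAut k (ι k 1) = ι k 1 + ι k 0 := by simp [jordanAut]

variable (k) in
/-- The inverse of `jordanAut`. -/
noncomputable def jordanInv : FreeAlgebra k (Fin 2) →ₐ[k] FreeAlgebra k (Fin 2) :=
  FreeAlgebra.lift k ![ι k (0 : Fin 2), ι k (1 : Fin 2) - ι k (0 : Fin 2)]

@[simp]
theorem jordanInv_ι_zero : jordanInv k (ι k 0) = ι k 0 := by simp [jordanInv]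

@[simp]
theorem jordanInv_ι_one : jordanInv k (ι k 1) = ι k 1 - ι k 0 := by simp [jordanInv]

@[simp]
theorem jordanInv_jordanAut (z : FreeAlgebra k (Fin 2)) : jordanInv k (jordanAut k z) = z := by
  refine DFunLike.congr_fun (f := (jordanInv k).comp (jordanAut k)) (g := AlgHom.id k _) ?_ z
  ext i
  fin_cases i <;> simp

@[simp]
theorem jordanAut_jordanInv (z : FreeAlgebra k (Fin 2)) : jordanAut k (jordanInv k z) = z := by
  refine DFunLike.congr_fun (f := (jordanAut k).comp (jordanInv k)) (g := AlgHom.id k _) ?_ z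
  ext i
  fin_cases i <;> simp

theorem map_degComp_le (f : FreeAlgebra k (Fin 2) →ₐ[k] FreeAlgebra k (Fin 2))
    (hf : ∀ i, f (ι k i) ∈ degComp k 1) {n : ℕ} {z : FreeAlgebra k (Fin 2)}
    (hz : z ∈ degComp k n) : f z ∈ degComp k n := by
  have h1 : (Submodule.span k (Set.range (ι k))).map f.toLinearMap ≤
      Submodule.span k (Set.range (ι k : Fin 2 → FreeAlgebra k (Fin 2))) := by
    rw [Submodule.map_span_le]
    rintro _ ⟨i, rfl⟩
    simpa [degComp] using hf i
  have h2 := Submodule.mem_map_of_mem (f := f.toLinearMap) hz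
  rw [degComp, Submodule.map_pow] at h2
  exact pow_le_pow_left' h1 n h2

theorem ι_mem_degComp_one (i : Fin 2) : ι k i ∈ degComp k 1 := by
  rw [degComp, pow_one]
  exact Submodule.subset_span ⟨i, rfl⟩

theorem jordanAut_mem_degComp {n : ℕ} {z : FreeAlgebra k (Fin 2)} (hz : z ∈ degComp k n) :
    jordanAut k z ∈ degComp k n := by
  refine map_degComp_le _ (fun i => ?_) hz
  fin_cases i
  · simpa using ι_mem_degComp_one 0
  · simpa using add_mem (ι_mem_degComp_one 1) (ι_mem_degComp_one 0)

theorem jordanInv_mem_degComp {n : ℕ} {z : FreeAlgebra k (Fin 2)} (hz : z ∈ degComp k n) :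
    jordanInv k z ∈ degComp k n := by
  refine map_degComp_le _ (fun i => ?_) hz
  fin_cases i
  · simpa using ι_mem_degComp_one 0
  · simpa using sub_mem (ι_mem_degComp_one (k := k) 1) (ι_mem_degComp_one 0)

/-- The skew derivations `∂₁, ∂₂` attached to the block `V(1,2)`. -/
structure IsJordanSkewDerivation
    (D : Fin 2 → (FreeAlgebra k (Fin 2) →ₗ[k] FreeAlgebra k (Fin 2))) : Prop where
  apply_one : ∀ i, D i 1 = 0
  apply_ι : ∀ i j, D i (ι k j) = if i = j then 1 else 0
  apply_mul : ∀ i u v, D i (u * v) = D i u * jordanAut k v + u * D i v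

variable {D : Fin 2 → (FreeAlgebra k (Fin 2) →ₗ[k] FreeAlgebra k (Fin 2))}

namespace IsJordanSkewDerivation

theorem apply_algebraMap (hD : IsJordanSkewDerivation D) (i : Fin 2) (c : k) :
    D i (algebraMap k _ c) = 0 := by
  rw [Algebra.algebraMap_eq_smul_one, map_smul, hD.apply_one, smul_zero]

theorem apply_jordanAut (hD : IsJordanSkewDerivation D) (z : FreeAlgebra k (Fin 2)) :
    D 0 (jordanAut k z) = jordanAut k (D 0 z + D 1 z) ∧
      D 1 (jordanAut k z) = jordanAut k (D 1 z) := by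
  induction z using FreeAlgebra.induction with
  | grade0 c => simp [hD.apply_algebraMap]
  | grade1 i => fin_cases i <;> simp [hD.apply_ι]
  | mul a b ha hb =>
    simp only [map_mul, hD.apply_mul, ha.1, ha.2, hb.1, hb.2, map_add]
    exact ⟨by noncomm_ring, trivial⟩
  | add a b ha hb =>
    simp only [map_add, ha.1, ha.2, hb.1, hb.2]
    exact ⟨by abel, trivial⟩

theorem apply_jordanInv (hD : IsJordanSkewDerivation D) (z : FreeAlgebra k (Fin 2)) :
    D 0 (jordanInv k z) = jordanInv k (D 0 z - D 1 z) ∧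
      D 1 (jordanInv k z) = jordanInv k (D 1 z) := by
  have h := hD.apply_jordanAut (jordanInv k z)
  rw [jordanAut_jordanInv] at h
  rw [h.1, h.2]
  simp

theorem apply_mem_degComp (hD : IsJordanSkewDerivation D) (i : Fin 2) {n : ℕ}
    {z : FreeAlgebra k (Fin 2)} (hz : z ∈ degComp k (n + 1)) : D i z ∈ degComp k n := by
  have h1 : ∀ w ∈ degComp k 1, D i w ∈ (1 : Submodule k (FreeAlgebra k (Fin 2))) := by
    intro w hw
    rw [degComp, pow_one] at hw
    induction hw using Submodule.span_induction with
    | mem x hx =>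
      obtain ⟨j, rfl⟩ := hx
      rw [hD.apply_ι]
      split_ifs
      · exact Submodule.one_le.1 le_rfl
      · exact zero_mem _
    | zero => simp
    | add x y _ _ hx hy => rw [map_add]; exact add_mem hx hy
    | smul c x _ hx => rw [map_smul]; exact Submodule.smul_mem _ _ hx
  induction n generalizing z with
  | zero => simpa [degComp] using h1 z hz
  | succ n ih =>
    rw [degComp, pow_succ] at hz
    induction hz using Submodule.mul_induction_on' with
    | mem_mul_mem a ha b hb =>
      have hb' : b ∈ degComp k 1 := by simpa [degComp] using hb
      rw [hD.apply_mul]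
      refine add_mem ?_ ?_
      · rw [degComp, pow_succ]
        exact Submodule.mul_mem_mul (ih ha) (by simpa [degComp] using jordanAut_mem_degComp hb')
      · rw [← mul_one (degComp k (n + 1))]
        exact Submodule.mul_mem_mul ha (h1 b hb')
    | add x _ y _ hx hy => rw [map_add]; exact add_mem hx hy

theorem forall_foldr_succ {n : ℕ} {x : FreeAlgebra k (Fin 2)} :
    (∀ l : List (Fin 2), l.length = n + 1 → l.foldr (fun i y => D i y) x = 0) ↔
      ∀ i, ∀ l : List (Fin 2), l.length = n → l.foldr (fun i y => D i y) (D i x) = 0 := by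
  constructor
  · intro h i l hl
    simpa using h (l ++ [i]) (by simp [hl])
  · intro h l hl
    obtain rfl | ⟨l, i, rfl⟩ := List.eq_nil_or_concat l
    · simp at hl
    · simpa using h i l (by simpa using hl)

variable (D) in
/-- The submodule of elements killed by all `n`-fold compositions of skew derivations. -/
def annihilator : ℕ → Submodule k (FreeAlgebra k (Fin 2))
  | 0 => ⊥
  | n + 1 => ⨅ i, (annihilator n).comap (D i)

theorem mem_annihilator_succ {n : ℕ} {x : FreeAlgebra k (Fin 2)} :
    x ∈ annihilator D (n + 1) ↔ ∀ i, D i x ∈ annihilator D n := by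
  simp [annihilator]

theorem mem_annihilator_iff {n : ℕ} {x : FreeAlgebra k (Fin 2)} :
    x ∈ annihilator D n ↔
      ∀ l : List (Fin 2), l.length = n → l.foldr (fun i y => D i y) x = 0 := by
  induction n generalizing x with
  | zero => simp [annihilator]
  | succ n ih => simp only [mem_annihilator_succ, forall_foldr_succ, ih]

theorem jordanAut_mem_annihilator (hD : IsJordanSkewDerivation D) {n : ℕ}
    {x : FreeAlgebra k (Fin 2)} (hx : x ∈ annihilator D n) :
    jordanAut k x ∈ annihilator D n := by
  induction n generalizing x with
  | zero => simp_all [annihilator]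
  | succ n ih =>
    rw [mem_annihilator_succ, Fin.forall_fin_two] at hx ⊢
    rw [(hD.apply_jordanAut x).1, (hD.apply_jordanAut x).2]
    exact ⟨ih (add_mem hx.1 hx.2), ih hx.2⟩

theorem jordanInv_mem_annihilator (hD : IsJordanSkewDerivation D) {n : ℕ}
    {x : FreeAlgebra k (Fin 2)} (hx : x ∈ annihilator D n) :
    jordanInv k x ∈ annihilator D n := by
  induction n generalizing x with
  | zero => simp_all [annihilator]
  | succ n ih =>
    rw [mem_annihilator_succ, Fin.forall_fin_two] at hx ⊢
    rw [(hD.apply_jordanInv x).1, (hD.apply_jordanInv x).2]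
    exact ⟨ih (sub_mem hx.1 hx.2), ih hx.2⟩

theorem mem_nicholsSet_iff {x : FreeAlgebra k (Fin 2)} :
    x ∈ nicholsSet D ↔ ∃ n, 2 ≤ n ∧ x ∈ degComp k n ∧ x ∈ annihilator D n := by
  simp only [nicholsSet, mem_annihilator_iff, Set.mem_ofPred_eq]

theorem eq_zero_of_mem_degComp_one (hD : IsJordanSkewDerivation D) {x : FreeAlgebra k (Fin 2)}
    (hx : x ∈ degComp k 1) (h : x ∈ annihilator D 1) : x = 0 := by
  rw [degComp, pow_one, Submodule.mem_span_range_iff_exists_fun] at hx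
  obtain ⟨c, rfl⟩ := hx
  have h0 := Submodule.mem_bot k |>.1 (mem_annihilator_succ.1 h 0)
  have h1 := Submodule.mem_bot k |>.1 (mem_annihilator_succ.1 h 1)
  simp only [Fin.sum_univ_two, map_add, map_smul, hD.apply_ι] at h0 h1
  simp_all

theorem jordanAut_mem_span (hD : IsJordanSkewDerivation D) {x : FreeAlgebra k (Fin 2)}
    (hx : x ∈ TwoSidedIdeal.span (nicholsSet D)) :
    jordanAut k x ∈ TwoSidedIdeal.span (nicholsSet D) := by
  have h : TwoSidedIdeal.span (nicholsSet D) ≤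
      (TwoSidedIdeal.span (nicholsSet D)).comap (jordanAut k) := by
    refine TwoSidedIdeal.span_le.2 fun z hz => (TwoSidedIdeal.mem_comap _).2 ?_
    obtain ⟨n, hn, hz, hz'⟩ := mem_nicholsSet_iff.1 hz
    exact TwoSidedIdeal.subset_span (mem_nicholsSet_iff.2
      ⟨n, hn, jordanAut_mem_degComp hz, hD.jordanAut_mem_annihilator hz'⟩)
  exact (TwoSidedIdeal.mem_comap _).1 (h hx)

theorem jordanInv_mem_span (hD : IsJordanSkewDerivation D) {x : FreeAlgebra k (Fin 2)}
    (hx : x ∈ TwoSidedIdeal.span (nicholsSet D)) :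
    jordanInv k x ∈ TwoSidedIdeal.span (nicholsSet D) := by
  have h : TwoSidedIdeal.span (nicholsSet D) ≤
      (TwoSidedIdeal.span (nicholsSet D)).comap (jordanInv k) := by
    refine TwoSidedIdeal.span_le.2 fun z hz => (TwoSidedIdeal.mem_comap _).2 ?_
    obtain ⟨n, hn, hz, hz'⟩ := mem_nicholsSet_iff.1 hz
    exact TwoSidedIdeal.subset_span (mem_nicholsSet_iff.2
      ⟨n, hn, jordanInv_mem_degComp hz, hD.jordanInv_mem_annihilator hz'⟩)
  exact (TwoSidedIdeal.mem_comap _).1 (h hx)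

theorem apply_mem_span (hD : IsJordanSkewDerivation D) (i : Fin 2) {x : FreeAlgebra k (Fin 2)}
    (hx : x ∈ TwoSidedIdeal.span (nicholsSet D)) :
    D i x ∈ TwoSidedIdeal.span (nicholsSet D) := by
  induction hx using TwoSidedIdeal.span_induction with
  | mem x hx =>
    obtain ⟨n, hn, hx, hx'⟩ := mem_nicholsSet_iff.1 hx
    obtain ⟨n, rfl⟩ : ∃ m, n = m + 1 := ⟨n - 1, by omega⟩
    have h1 := hD.apply_mem_degComp i hx
    have h2 := mem_annihilator_succ.1 hx' i
    obtain rfl | hn := (show 1 ≤ n by omega).eq_or_lt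
    · rw [hD.eq_zero_of_mem_degComp_one h1 h2]
      exact zero_mem _
    · exact TwoSidedIdeal.subset_span (mem_nicholsSet_iff.2 ⟨n, hn, h1, h2⟩)
  | zero => rw [map_zero]; exact zero_mem _
  | add x y _ _ hx hy => rw [map_add]; exact add_mem hx hy
  | neg x _ hx => rw [map_neg]; exact neg_mem hx
  | left_absorb a x hx ih =>
    rw [hD.apply_mul]
    exact add_mem (TwoSidedIdeal.mul_mem_left _ _ _ (hD.jordanAut_mem_span hx))
      (TwoSidedIdeal.mul_mem_left _ _ _ ih)
  | right_absorb a x hx ih =>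
    rw [hD.apply_mul]
    exact add_mem (TwoSidedIdeal.mul_mem_right _ _ _ ih)
      (TwoSidedIdeal.mul_mem_right _ _ _ hx)

variable (k) in
/-- The algebra map `x₁ ↦ 0`, `x₂ ↦ X` onto the polynomial ring. -/
noncomputable def toPolynomial : FreeAlgebra k (Fin 2) →ₐ[k] Polynomial k :=
  FreeAlgebra.lift k ![0, Polynomial.X]

@[simp]
theorem toPolynomial_ι_zero : toPolynomial k (ι k 0) = 0 := by simp [toPolynomial]

@[simp]
theorem toPolynomial_ι_one : toPolynomial k (ι k 1) = Polynomial.X := by simp [toPolynomial]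

theorem toPolynomial_jordanAut (z : FreeAlgebra k (Fin 2)) :
    toPolynomial k (jordanAut k z) = toPolynomial k z := by
  refine DFunLike.congr_fun (f := (toPolynomial k).comp (jordanAut k)) (g := toPolynomial k) ?_ z
  ext i
  fin_cases i <;> simp

theorem toPolynomial_apply_one (hD : IsJordanSkewDerivation D) (z : FreeAlgebra k (Fin 2)) :
    toPolynomial k (D 1 z) = Polynomial.derivative (toPolynomial k z) := by
  induction z using FreeAlgebra.induction with
  | grade0 c => simp [hD.apply_algebraMap, Polynomial.algebraMap_eq]
  | grade1 i => fin_cases i <;> simp [hD.apply_ι]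
  | mul a b ha hb => simp [hD.apply_mul, ha, hb, toPolynomial_jordanAut]
  | add a b ha hb => simp [ha, hb]

theorem toPolynomial_iterate_apply_one (hD : IsJordanSkewDerivation D) (n : ℕ)
    (z : FreeAlgebra k (Fin 2)) :
    toPolynomial k ((D 1)^[n] z) = Polynomial.derivative^[n] (toPolynomial k z) :=
  Function.Semiconj.iterate_right (f := toPolynomial k) hD.toPolynomial_apply_one n z

theorem coeff_zero_toPolynomial_eq_zero {n : ℕ} (hn : 0 < n) {x : FreeAlgebra k (Fin 2)}
    (hx : x ∈ degComp k n) : (toPolynomial k x).coeff 0 = 0 := by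
  obtain ⟨n, rfl⟩ : ∃ m, n = m + 1 := ⟨n - 1, by omega⟩
  rw [degComp, pow_succ] at hx
  induction hx using Submodule.mul_induction_on' with
  | mem_mul_mem a _ b hb =>
    rw [Submodule.mem_span_range_iff_exists_fun] at hb
    obtain ⟨c, rfl⟩ := hb
    simp [Polynomial.mul_coeff_zero]
  | add x _ y _ hx hy => simp [hx, hy]

theorem coeff_zero_toPolynomial_of_mem_span {x : FreeAlgebra k (Fin 2)}
    (hx : x ∈ TwoSidedIdeal.span (nicholsSet D)) : (toPolynomial k x).coeff 0 = 0 := by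
  induction hx using TwoSidedIdeal.span_induction with
  | mem x hx =>
    obtain ⟨n, hn, hx, -⟩ := hx
    exact coeff_zero_toPolynomial_eq_zero (by omega) hx
  | zero => simp
  | add x y _ _ hx hy => simp [hx, hy]
  | neg x _ hx => simp [hx]
  | left_absorb a x hx ih => simp [Polynomial.mul_coeff_zero, ih]
  | right_absorb a x hx ih => simp [Polynomial.mul_coeff_zero, ih]

theorem toPolynomial_eq_zero_of_mem_span [CharZero k] (hD : IsJordanSkewDerivation D)
    {x : FreeAlgebra k (Fin 2)} (hx : x ∈ TwoSidedIdeal.span (nicholsSet D)) :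
    toPolynomial k x = 0 := by
  ext n
  have h : (D 1)^[n] x ∈ TwoSidedIdeal.span (nicholsSet D) := by
    induction n with
    | zero => exact hx
    | succ n ih =>
      rw [Function.iterate_succ_apply']
      exact hD.apply_mem_span 1 ih
  have h0 := coeff_zero_toPolynomial_of_mem_span h
  rw [hD.toPolynomial_iterate_apply_one, Polynomial.coeff_iterate_derivative, zero_add,
    Nat.descFactorial_self, nsmul_eq_mul, mul_eq_zero] at h0
  simpa [Nat.factorial_ne_zero] using h0

theorem apply_zero_ι_one_pow (hD : IsJordanSkewDerivation D) (b : ℕ) : D 0 (ι k 1 ^ b) = 0 := by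
  induction b with
  | zero => simpa using hD.apply_one 0
  | succ b ih => simp [pow_succ, hD.apply_mul, hD.apply_ι, ih]

theorem apply_zero_ι_zero_pow (hD : IsJordanSkewDerivation D) (a : ℕ) :
    D 0 (ι k 0 ^ a) = (a : k) • ι k 0 ^ (a - 1) := by
  induction a with
  | zero => simpa using hD.apply_one 0
  | succ a ih =>
    rw [pow_succ, hD.apply_mul, ih, hD.apply_ι]
    rcases a with _ | a
    · simp
    · simp only [jordanAut_ι_zero, smul_mul_assoc, ← pow_succ, Nat.add_sub_cancel]
      simp [add_smul]

variable (D) in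
/-- The skew derivation `∂₁` twisted by the inverse of the action of the generator. -/
noncomputable def twistedZero : FreeAlgebra k (Fin 2) →ₗ[k] FreeAlgebra k (Fin 2) :=
  (jordanInv k).toLinearMap ∘ₗ D 0

theorem twistedZero_orderedMonomial (hD : IsJordanSkewDerivation D) (p : ℕ × ℕ) :
    twistedZero D (orderedMonomial (ι k 0) (ι k 1) p) =
      (p.1 : k) • orderedMonomial (ι k 0) (ι k 1) (p.1 - 1, p.2) := by
  simp [twistedZero, orderedMonomial, hD.apply_mul, hD.apply_zero_ι_one_pow,
    hD.apply_zero_ι_zero_pow]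

theorem twistedZero_iterate_orderedMonomial (hD : IsJordanSkewDerivation D) (n : ℕ) (p : ℕ × ℕ) :
    (twistedZero D ^ n) (orderedMonomial (ι k 0) (ι k 1) p) =
      (p.1.descFactorial n : k) • orderedMonomial (ι k 0) (ι k 1) (p.1 - n, p.2) := by
  induction n with
  | zero => simp
  | succ n ih =>
    rw [pow_succ', Module.End.mul_apply, ih, map_smul, hD.twistedZero_orderedMonomial, smul_smul,
      Nat.descFactorial_succ, Nat.cast_mul, mul_comm, Nat.sub_sub]

theorem coeff_toPolynomial_twistedZero (hD : IsJordanSkewDerivation D) (p q : ℕ × ℕ) :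
    (toPolynomial k ((twistedZero D ^ q.1) (orderedMonomial (ι k 0) (ι k 1) p))).coeff q.2 =
      if p = q then (q.1.factorial : k) else 0 := by
  rw [hD.twistedZero_iterate_orderedMonomial, map_smul, map_orderedMonomial, toPolynomial_ι_zero,
    toPolynomial_ι_one, orderedMonomial, Polynomial.coeff_smul]
  rcases lt_trichotomy p.1 q.1 with h | h | h
  · rw [Nat.descFactorial_of_lt h, if_neg (by rintro rfl; exact h.false)]
    simp
  · simp [h, Nat.descFactorial_self, Prod.ext_iff, Polynomial.coeff_X_pow, eq_comm]
  · rw [zero_pow (by simp only; omega), if_neg (by rintro rfl; exact h.false)]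
    simp

theorem eq_zero_of_linearCombination_mem [CharZero k] (hD : IsJordanSkewDerivation D)
    {c : ℕ × ℕ →₀ k}
    (hc : Finsupp.linearCombination k (orderedMonomial (ι k 0) (ι k 1)) c ∈
      TwoSidedIdeal.span (nicholsSet D)) : c = 0 := by
  ext q
  have hmem : ∀ n, (twistedZero D ^ n)
      (Finsupp.linearCombination k (orderedMonomial (ι k 0) (ι k 1)) c) ∈
        TwoSidedIdeal.span (nicholsSet D) := by
    intro n
    induction n with
    | zero => exact hc
    | succ n ih =>
      rw [pow_succ', Module.End.mul_apply]
      exact hD.jordanInv_mem_span (hD.apply_mem_span 0 ih)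
  have h := congrArg (Polynomial.coeff · q.2) (hD.toPolynomial_eq_zero_of_mem_span (hmem q.1))
  simp only [Finsupp.linearCombination_apply, Finsupp.sum, map_sum, map_smul,
    Polynomial.finsetSum_coeff, Polynomial.coeff_smul, hD.coeff_toPolynomial_twistedZero] at h
  simpa [Nat.factorial_ne_zero] using h

variable (k) in
/-- The defining relation of the Jordan plane. -/
noncomputable def jordanRelator : FreeAlgebra k (Fin 2) :=
  ι k 1 * ι k 0 - ι k 0 * ι k 1 + (2 : k)⁻¹ • (ι k 0 * ι k 0)

theorem jordanRelator_mem_nicholsSet [CharZero k] (hD : IsJordanSkewDerivation D) :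
    jordanRelator k ∈ nicholsSet D := by
  refine mem_nicholsSet_iff.2 ⟨2, le_rfl, ?_, ?_⟩
  · have h : ∀ i j : Fin 2, ι k i * ι k j ∈ degComp k 2 := fun i j => by
      have := Submodule.mul_mem_mul (ι_mem_degComp_one (k := k) i) (ι_mem_degComp_one j)
      simpa only [degComp, ← pow_add] using this
    exact add_mem (sub_mem (h _ _) (h _ _)) (Submodule.smul_mem _ _ (h _ _))
  · have h : ∀ i, D i (jordanRelator k) = 0 := by
      have h2 : (2 : k)⁻¹ • (ι k 0 + ι k 0 : FreeAlgebra k (Fin 2)) = ι k 0 := by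
        rw [← two_smul k, smul_smul, inv_mul_cancel₀ two_ne_zero, one_smul]
      rw [Fin.forall_fin_two]
      constructor
      · simp [jordanRelator, hD.apply_mul, hD.apply_ι, -smul_add, h2]
      · simp [jordanRelator, hD.apply_mul, hD.apply_ι]
    rw [mem_annihilator_succ]
    intro i
    rw [h]
    exact zero_mem _

theorem jordan_relation_of_map_eq_zero {A : Type*} [Ring A] [Algebra k A]
    (φ : FreeAlgebra k (Fin 2) →ₐ[k] A) (h : φ (jordanRelator k) = 0) :
    φ (ι k 1) * φ (ι k 0) =
      φ (ι k 0) * φ (ι k 1) - (2 : k)⁻¹ • (φ (ι k 0) * φ (ι k 0)) := by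
  simp only [jordanRelator, map_add, map_sub, map_mul, map_smul] at h
  rw [eq_sub_iff_add_eq, ← sub_eq_zero, ← h]
  abel

theorem span_nicholsSet_eq [CharZero k] (hD : IsJordanSkewDerivation D) :
    TwoSidedIdeal.span (nicholsSet D) = TwoSidedIdeal.span {jordanRelator k} := by
  have hle : TwoSidedIdeal.span {jordanRelator k} ≤ TwoSidedIdeal.span (nicholsSet D) :=
    TwoSidedIdeal.span_mono (Set.singleton_subset_iff.2 hD.jordanRelator_mem_nicholsSet)
  refine le_antisymm (fun z hz => ?_) hle
  set I := TwoSidedIdeal.span {jordanRelator k} with hI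
  let φ := I.ringCon.mkₐ k
  have hφ : ∀ a b, φ a = φ b ↔ a - b ∈ I := fun a b =>
    (RingCon.eq I.ringCon).trans (I.rel_iff a b)
  have hrel : φ (jordanRelator k) = 0 := by
    rw [← map_zero φ, hφ, sub_zero]
    exact TwoSidedIdeal.subset_span rfl
  have hspan := mem_span_range_orderedMonomial (jordan_relation_of_map_eq_zero φ hrel) rfl rfl z
  obtain ⟨c, hc⟩ := Finsupp.mem_span_range_iff_exists_finsupp.1 hspan
  have hc' : φ (Finsupp.linearCombination k (orderedMonomial (ι k 0) (ι k 1)) c) = φ z := by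
    simpa [Finsupp.linearCombination_apply, Finsupp.sum, map_orderedMonomial] using hc
  have hsub := (hφ _ _).1 hc'
  have : c = 0 := hD.eq_zero_of_linearCombination_mem (by simpa using add_mem (hle hsub) hz)
  simpa [this] using hsub

theorem mem_span_of_mkAlgHom_eq_zero {z : FreeAlgebra k (Fin 2)}
    (hz : RingQuot.mkAlgHom k (nicholsRel D) z = 0) : z ∈ TwoSidedIdeal.span (nicholsSet D) := by
  set I := TwoSidedIdeal.span (nicholsSet D) with hI
  let φ := I.ringCon.mkₐ k
  have hφ : ∀ a, φ a = 0 ↔ a ∈ I := fun a => RingCon.eq I.ringCon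
  have h : ∀ ⦃x y⦄, nicholsRel D x y → φ x = φ y := by
    rintro x _ ⟨hx, rfl⟩
    rw [map_zero, hφ]
    exact TwoSidedIdeal.subset_span hx
  rw [← hφ, ← RingQuot.liftAlgHom_mkAlgHom_apply k φ h, hz, map_zero]

end IsJordanSkewDerivation

end SkewDerivations

/-- the Jordan plane.  `J(V(1,2))` is generated as a two-sided ideal by
`x₂x₁ - x₁x₂ + ½x₁²`; the monomials `x₁^a x₂^b` form a basis of `B(V(1,2))`; and
`GKdim B(V(1,2)) = 2`. -/
theorem statement2 (k : Type*) [Field k] [IsAlgClosed k] [CharZero k]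
    (D : Fin 2 → (FreeAlgebra k (Fin 2) →ₗ[k] FreeAlgebra k (Fin 2)))
    (hD1 : ∀ i, D i (1 : FreeAlgebra k (Fin 2)) = 0)
    (hDx : ∀ i j, D i (FreeAlgebra.ι k j) = if i = j then 1 else 0)
    (hDmul : ∀ i (u v : FreeAlgebra k (Fin 2)),
      D i (u * v) = D i u * jordanAut k v + u * D i v) :
    TwoSidedIdeal.span (nicholsSet D) =
      TwoSidedIdeal.span
        {FreeAlgebra.ι k (1 : Fin 2) * FreeAlgebra.ι k (0 : Fin 2) -
          FreeAlgebra.ι k (0 : Fin 2) * FreeAlgebra.ι k (1 : Fin 2) +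
          ((2 : k)⁻¹) • (FreeAlgebra.ι k (0 : Fin 2) * FreeAlgebra.ι k (0 : Fin 2))} ∧
    (LinearIndependent k
        (fun p : ℕ × ℕ => RingQuot.mkAlgHom k (nicholsRel D)
          (FreeAlgebra.ι k (0 : Fin 2) ^ p.1 * FreeAlgebra.ι k (1 : Fin 2) ^ p.2)) ∧
      Submodule.span k
        (Set.range (fun p : ℕ × ℕ => RingQuot.mkAlgHom k (nicholsRel D)
          (FreeAlgebra.ι k (0 : Fin 2) ^ p.1 * FreeAlgebra.ι k (1 : Fin 2) ^ p.2))) = ⊤) ∧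
    GKdim k (RingQuot (nicholsRel D)) = 2 := by
  have hD : IsJordanSkewDerivation D := ⟨hD1, hDx, hDmul⟩
  set φ := RingQuot.mkAlgHom k (nicholsRel D) with hφ
  have hmon : (fun p : ℕ × ℕ => φ (FreeAlgebra.ι k (0 : Fin 2) ^ p.1 *
      FreeAlgebra.ι k (1 : Fin 2) ^ p.2)) =
      orderedMonomial (φ (FreeAlgebra.ι k 0)) (φ (FreeAlgebra.ι k 1)) :=
    funext fun p => map_orderedMonomial φ _ _ p
  have hrel := IsJordanSkewDerivation.jordan_relation_of_map_eq_zero φ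
    ((RingQuot.mkAlgHom_rel k ⟨hD.jordanRelator_mem_nicholsSet, rfl⟩).trans (map_zero _))
  have hsurj : Function.Surjective φ := RingQuot.mkAlgHom_surjective k _
  have hli : LinearIndependent k
      (orderedMonomial (φ (FreeAlgebra.ι k 0)) (φ (FreeAlgebra.ι k 1))) := by
    rw [linearIndependent_iff]
    intro c hc
    refine hD.eq_zero_of_linearCombination_mem
      (IsJordanSkewDerivation.mem_span_of_mkAlgHom_eq_zero ?_)
    simpa [Finsupp.linearCombination_apply, Finsupp.sum, map_orderedMonomial] using hc
  rw [hmon]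
  refine ⟨hD.span_nicholsSet_eq, ⟨hli, ?_⟩, GKdim_eq_two_of_jordan_relation hrel hli ?_⟩
  · refine eq_top_iff.2 fun x _ => ?_
    obtain ⟨z, rfl⟩ := hsurj x
    exact mem_span_range_orderedMonomial hrel rfl rfl z
  · intro x
    obtain ⟨z, rfl⟩ := hsurj x
    exact exists_mem_spanOneXY_pow rfl rfl z
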